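/- Let N ≥ 1 and let p_{ij}, d_{ij} : ℝ^N → ℝ (1 ≤ i,j ≤ N) be nonnegative, twice continuously differentiable functions with p_{ij}(z) = d_{ji}(z) and p_{ii}(z) = d_{ii}(z) = 0 for all z. Set P_i = Σ_j p_{ij}, D_i = Σ_j d_{ij}. Let y : [t_n, t_n + T] → ℝ^N solve y_i' = P_i(y) − D_i(y) with y(t_n) = yⁿ, all yⁿ_i > 0. Let α ≥ 1/2 and set a21 = α, b1 = 1 − 1/(2α), b2 = 1/(2α). Suppose Y2, Y : (0,T) → ℝ^N satisfy, for every Δt ∈ (0,T) and every i: Y2_i(Δt) > 0, Y2_i = yⁿ_i + α·Δt Σ_j ( p_{ij}(yⁿ)·Y2_j/yⁿ_j − d_{ij}(yⁿ)·Y2_i/yⁿ_i ), and Y_i = yⁿ_i + Δt Σ_j ( (b1·p_{ij}(yⁿ) + b2·p_{ij}(Y2))·Y_j/σ_j − (b1·d_{ij}(yⁿ) + b2·d_{ij}(Y2))·Y_i/σ_i ), where σ_i(Δt) = yⁿ_i·(Y2_i(Δt)/yⁿ_i)^{1/α}. Then Y_i(Δt) = y_i(t_n + Δt) + O(Δt³)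 as Δt → 0⁺ for every i. (The MPRK22(α) schemes with Patankar-weight denominators π_i = yⁿ_i and σ_i = yⁿ_i·(y^{(2)}_i/yⁿ_i)^{1/a21} are second order accurate.) -/

import Mathlib

/-- `f(Δt) = O(Δt^m)` as `Δt → 0⁺`. -/
def BigOAtZero (f : ℝ → ℝ) (m : ℕ) : Prop :=
  ∃ C > 0, ∃ δ > 0, ∀ t : ℝ, 0 < t → t < δ → |f t| ≤ C * t ^ m

open Filter Topology Asymptotics

/-- second order Taylor expansion along a curve -/
lemma taylor_curve {E : Type*} [NormedAddCommGroup E] [NormedSpace ℝ E] (h : E → ℝ) (x0 v : E)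
    (hh : ContDiffAt ℝ 2 h x0) (Z : ℝ → E)
    (hZ : (fun t => Z t - x0 - t • v) =O[𝓝[>] (0:ℝ)] fun t => t ^ 2) :
    (fun t => h (Z t) - h x0 - t * fderiv ℝ h x0 v) =O[𝓝[>] (0:ℝ)] fun t => t ^ 2 := by
  have ht0 : Tendsto (fun t : ℝ => t) (𝓝[>] (0:ℝ)) (𝓝 0) := tendsto_nhdsWithin_of_tendsto_nhds tendsto_id
  have hsq : (fun t : ℝ => t ^ 2) =O[𝓝[>] (0:ℝ)] fun t => t := by
    have h1 : (fun t : ℝ => t) =O[𝓝[>] (0:ℝ)] fun _ => (1:ℝ) := ht0.isBigO_one ℝ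
    simpa [pow_two] using h1.mul (isBigO_refl (fun t : ℝ => t) _)
  have hZ1 : (fun t => Z t - x0) =O[𝓝[>] (0:ℝ)] fun t => t := by
    have h2 : (fun t : ℝ => t • v) =O[𝓝[>] (0:ℝ)] fun t => t := by
      apply IsBigO.of_bound ‖v‖
      filter_upwards with t
      rw [norm_smul, mul_comm]
    refine ((hZ.trans hsq).add h2).congr_left fun t => by abel
  have hZt : Tendsto Z (𝓝[>] (0:ℝ)) (𝓝 x0) := by
    have := hZ1.trans_tendsto ht0
    simpa using this.add_const x0
  have hd : DifferentiableAt ℝ (fderiv ℝ h) x0 :=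
    (hh.fderiv_right (m := 1) (by norm_num)).differentiableAt (by norm_num)
  have hev : ∀ᶠ x in 𝓝 x0, DifferentiableAt ℝ h x :=
    (hh.eventually (by norm_num)).mono fun x hx => hx.differentiableAt (by norm_num)
  obtain ⟨C, hC⟩ := hd.isBigO_sub.bound
  obtain ⟨ε, hε, hball⟩ := Metric.eventually_nhds_iff_ball.1 (hev.and hC)
  have key : (fun x => h x - h x0 - fderiv ℝ h x0 (x - x0)) =O[𝓝 x0] fun x => ‖x - x0‖ ^ 2 := by
    apply IsBigO.of_bound C
    filter_upwards [Metric.ball_mem_nhds x0 hε] with x hx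
    have hsub : Metric.closedBall x0 ‖x - x0‖ ⊆ Metric.ball x0 ε := by
      apply Metric.closedBall_subset_ball
      simpa [dist_eq_norm] using hx
    have hC0 : ∀ z ∈ Metric.closedBall x0 ‖x - x0‖, ‖fderiv ℝ h z - fderiv ℝ h x0‖ ≤ |C| * ‖x - x0‖ := by
      intro z hz
      refine ((hball z (hsub hz)).2).trans ?_
      rw [mem_closedBall_iff_norm] at hz
      exact mul_le_mul (le_abs_self C) hz (norm_nonneg _) (abs_nonneg _)
    have hC1 : ‖fderiv ℝ h x - fderiv ℝ h x0‖ ≤ C * ‖x - x0‖ := (hball x hx).2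
    have hC2 : |C| * ‖x - x0‖ = C * ‖x - x0‖ := by
      rcases eq_or_lt_of_le (norm_nonneg (x - x0)) with h0 | h0
      · simp [← h0]
      · have : 0 ≤ C := by
          by_contra hneg
          have := mul_neg_of_neg_of_pos (not_le.1 hneg) h0
          linarith [norm_nonneg (fderiv ℝ h x - fderiv ℝ h x0)]
        rw [abs_of_nonneg this]
    have := (convex_closedBall x0 ‖x - x0‖).norm_image_sub_le_of_norm_hasFDerivWithin_le'
      (f := h) (f' := fderiv ℝ h) (φ := fderiv ℝ h x0) (x := x0) (y := x)
      (fun z hz => (hball z (hsub hz)).1.hasFDerivAt.hasFDerivWithinAt) hC0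
      (Metric.mem_closedBall_self (norm_nonneg _)) (by simp [dist_eq_norm])
    rw [hC2] at this
    simpa [pow_two, mul_assoc] using this
  have k2 := key.comp_tendsto hZt
  have k3 : (fun t => ‖Z t - x0‖ ^ 2) =O[𝓝[>] (0:ℝ)] fun t => t ^ 2 := hZ1.norm_left.pow 2
  have k4 : (fun t => fderiv ℝ h x0 (Z t - x0 - t • v)) =O[𝓝[>] (0:ℝ)] fun t => t ^ 2 :=
    ((fderiv ℝ h x0).isBigO_comp _ _).trans hZ
  refine ((k2.trans k3).add k4).congr_left fun t => ?_
  simp only [Function.comp, map_sub, map_smul, smul_eq_mul]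
  ring

lemma mvt_O (g g' : ℝ → ℝ) (T : ℝ) (hT : 0 < T) (m : ℕ)
    (hg : ∀ t ∈ Set.Icc 0 T, HasDerivWithinAt g (g' t) (Set.Icc 0 T) t)
    (h0 : g 0 = 0) (h0' : g' 0 = 0) (hO : g' =O[𝓝[>] (0:ℝ)] fun t => t ^ m) :
    g =O[𝓝[>] (0:ℝ)] fun t => t ^ (m + 1) := by
  obtain ⟨C, hCp, hC⟩ := hO.exists_pos
  obtain ⟨δ, hδ, hb⟩ := mem_nhdsGT_iff_exists_Ioo_subset.1 hC.bound
  have hδ' : (0:ℝ) < δ := hδ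
  apply IsBigO.of_bound C
  filter_upwards [Ioo_mem_nhdsGT (lt_min hδ' hT)] with t ht
  have ht1 : t < δ := ht.2.trans_le (min_le_left _ _)
  have ht2 : t < T := ht.2.trans_le (min_le_right _ _)
  have hsub : Set.Icc 0 t ⊆ Set.Icc 0 T := Set.Icc_subset_Icc le_rfl ht2.le
  have := norm_image_sub_le_of_norm_deriv_le_segment' (f := g) (f' := g') (a := 0) (b := t)
    (C := C * t ^ m) (fun x hx => (hg x (hsub hx)).mono hsub) (by
      intro x hx
      rcases eq_or_lt_of_le hx.1 with h | h
      · rw [← h, h0', norm_zero]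
        have := ht.1
        positivity
      · have hh : ‖g' x‖ ≤ C * ‖x ^ m‖ := hb ⟨h, hx.2.trans ht1⟩
        rw [Real.norm_of_nonneg (r := x ^ m) (by positivity)] at hh
        refine hh.trans ?_
        have := hx.2.le
        gcongr) t ⟨ht.1.le, le_rfl⟩
  rw [h0, sub_zero, sub_zero] at this
  have ht0 := ht.1
  rw [Real.norm_of_nonneg (r := t ^ (m+1)) (by positivity), pow_succ, ← mul_assoc]
  exact this

/-- generic production-destruction step with weights near one -/
lemma step_O {N : ℕ} (yn : Fin N → ℝ) (Y w : ℝ → Fin N → ℝ) (q r : Fin N → Fin N → ℝ → ℝ) (k : ℕ)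
    (hq : ∀ i j, q i j =O[𝓝[>] (0:ℝ)] fun _ => (1:ℝ))
    (hr : ∀ i j, r i j =O[𝓝[>] (0:ℝ)] fun _ => (1:ℝ))
    (hw : ∀ i, (fun t => w t i - 1) =O[𝓝[>] (0:ℝ)] fun t => t ^ k)
    (hY : ∀ᶠ t in 𝓝[>] (0:ℝ), ∀ i, Y t i = yn i + t * ∑ j, (q i j t * w t j - r i j t * w t i)) (i) :
    (fun t => Y t i - yn i - t * ∑ j, (q i j t - r i j t)) =O[𝓝[>] (0:ℝ)] fun t => t ^ (k + 1) := by
  have h1 : (fun t => t * ∑ j, (q i j t * (w t j - 1) - r i j t * (w t i - 1)))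
      =O[𝓝[>] (0:ℝ)] fun t => t * t ^ k := by
    refine (isBigO_refl _ _).mul (IsBigO.fun_sum fun j _ => ?_)
    have a := (hq i j).mul (hw j)
    have b := (hr i j).mul (hw i)
    simp only [one_mul] at a b
    exact a.sub b
  simp only [pow_succ']
  refine h1.congr' ?_ EventuallyEq.rfl
  filter_upwards [hY] with t ht
  have h2 : Y t i - yn i = t * ∑ j, (q i j t * w t j - r i j t * w t i) := by linarith [ht i]
  rw [h2, ← mul_sub, ← Finset.sum_sub_distrib]
  congr 1
  exact Finset.sum_congr rfl fun j _ => by ring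

/-- a priori bound -/
lemma lin_bdd {N : ℕ} (yn : Fin N → ℝ) (Y : ℝ → Fin N → ℝ) (q r : Fin N → Fin N → ℝ → ℝ)
    (hq : ∀ i j, q i j =O[𝓝[>] (0:ℝ)] fun _ => (1:ℝ))
    (hr : ∀ i j, r i j =O[𝓝[>] (0:ℝ)] fun _ => (1:ℝ))
    (hY : ∀ᶠ t in 𝓝[>] (0:ℝ), ∀ i, Y t i = yn i + t * ∑ j, (q i j t * Y t j - r i j t * Y t i)) (i) :
    (fun t => Y t i - yn i) =O[𝓝[>] (0:ℝ)] fun t => t ^ 1 := by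
  have ht0 : Tendsto (fun t : ℝ => t) (𝓝[>] (0:ℝ)) (𝓝 0) := tendsto_nhdsWithin_of_tendsto_nhds tendsto_id
  have hYi : ∀ j, (fun t => Y t j) =O[𝓝[>] (0:ℝ)] fun t => ‖Y t‖ := fun j =>
    IsBigO.of_bound 1 (Eventually.of_forall fun t => by simpa using norm_le_pi_norm (Y t) j)
  have h1 : ∀ i, (fun t => Y t i - yn i) =O[𝓝[>] (0:ℝ)] fun t => t * ‖Y t‖ := by
    intro i
    have : (fun t => t * ∑ j, (q i j t * Y t j - r i j t * Y t i)) =O[𝓝[>] (0:ℝ)] fun t => t * ‖Y t‖ := by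
      refine (isBigO_refl _ _).mul (IsBigO.fun_sum fun j _ => ?_)
      have a := (hq i j).mul (hYi j)
      have b := (hr i j).mul (hYi i)
      simp only [one_mul] at a b
      exact a.sub b
    refine this.congr' ?_ EventuallyEq.rfl
    filter_upwards [hY] with t ht
    linarith [ht i]
  have h2 : (fun t => Y t - yn) =O[𝓝[>] (0:ℝ)] fun t => t * ‖Y t‖ := isBigO_pi.2 h1
  have h3 : (fun t => t * ‖Y t‖) =o[𝓝[>] (0:ℝ)] fun t => Y t := by
    have a : (fun t : ℝ => t) =o[𝓝[>] (0:ℝ)] fun _ => (1:ℝ) := (isLittleO_one_iff ℝ).2 ht0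
    have := a.mul_isBigO (isBigO_refl (fun t => ‖Y t‖) (𝓝[>] (0:ℝ)))
    simp only [one_mul] at this
    exact this.norm_right.congr_right (fun t => by simp) |>.of_norm_right
  have h4 := (h2.trans_isLittleO h3).right_isBigO_sub
  have h5 : (fun t => ‖Y t‖) =O[𝓝[>] (0:ℝ)] fun _ => (1:ℝ) := by
    refine (h4.trans ?_).norm_left
    refine (isBigO_const_const yn (one_ne_zero (α := ℝ)) _).congr_left fun t => by simp
  have h6 := (isBigO_refl (fun t : ℝ => t) (𝓝[>] (0:ℝ))).mul h5
  simpa using (h1 i).trans h6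

theorem stmt_16 (N : ℕ) (hN : 1 ≤ N)
    (p d : Fin N → Fin N → (Fin N → ℝ) → ℝ)
    (hpnn : ∀ i j z, 0 ≤ p i j z) (hdnn : ∀ i j z, 0 ≤ d i j z)
    (hpC2 : ∀ i j, ContDiff ℝ 2 (p i j)) (hdC2 : ∀ i j, ContDiff ℝ 2 (d i j))
    (hcons : ∀ i j z, p i j z = d j i z)
    (hpdiag : ∀ i z, p i i z = 0) (hddiag : ∀ i z, d i i z = 0)
    (P D : Fin N → (Fin N → ℝ) → ℝ)
    (hP : ∀ i z, P i z = ∑ j, p i j z) (hD : ∀ i z, D i z = ∑ j, d i j z)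
    (tn T : ℝ) (hT : 0 < T)
    (y : ℝ → Fin N → ℝ)
    (hy : ∀ (i : Fin N), ∀ t ∈ Set.Icc tn (tn + T),
      HasDerivWithinAt (fun s => y s i) (P i (y t) - D i (y t)) (Set.Icc tn (tn + T)) t)
    (yn : Fin N → ℝ) (hyn : y tn = yn) (hynpos : ∀ i, 0 < yn i)
    (α : ℝ) (hα : 1 / 2 ≤ α)
    (b1 b2 : ℝ) (hb1 : b1 = 1 - 1 / (2 * α)) (hb2 : b2 = 1 / (2 * α))
    (Y2 Y σ : ℝ → Fin N → ℝ)
    (hY2pos : ∀ Δt, 0 < Δt → Δt < T → ∀ i, 0 < Y2 Δt i)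
    (hσ : ∀ Δt, 0 < Δt → Δt < T → ∀ i,
      σ Δt i = yn i * (Y2 Δt i / yn i) ^ (1 / α))
    (hY2 : ∀ Δt, 0 < Δt → Δt < T → ∀ i,
      Y2 Δt i = yn i + α * Δt * ∑ j,
        (p i j yn * Y2 Δt j / yn j - d i j yn * Y2 Δt i / yn i))
    (hY : ∀ Δt, 0 < Δt → Δt < T → ∀ i,
      Y Δt i = yn i + Δt * ∑ j,
        ((b1 * p i j yn + b2 * p i j (Y2 Δt)) * Y Δt j / σ Δt j
          - (b1 * d i j yn + b2 * d i j (Y2 Δt)) * Y Δt i / σ Δt i)) :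
    ∀ i, BigOAtZero (fun Δt => Y Δt i - y (tn + Δt) i) 3 := by
  have hα0 : 0 < α := by linarith
  have ht0 : Tendsto (fun t : ℝ => t) (𝓝[>] (0:ℝ)) (𝓝 0) := tendsto_nhdsWithin_of_tendsto_nhds tendsto_id
  have ht1 : (fun t : ℝ => t ^ 1) =O[𝓝[>] (0:ℝ)] fun _ => (1:ℝ) := by
    simpa using ht0.isBigO_one ℝ
  have ht21 : (fun t : ℝ => t ^ 2) =O[𝓝[>] (0:ℝ)] fun t => t ^ 1 := by
    simpa [pow_two] using ht1.mul (isBigO_refl (fun t : ℝ => t) _)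
  have hcst : ∀ c : ℝ, (fun _ : ℝ => c) =O[𝓝[>] (0:ℝ)] fun _ => (1:ℝ) := fun c =>
    isBigO_const_const c one_ne_zero _
  have htc : ∀ c : ℝ, (fun t : ℝ => t * c) =O[𝓝[>] (0:ℝ)] fun t => t ^ 1 := fun c => by
    simpa using (isBigO_refl (fun t : ℝ => t) (𝓝[>] (0:ℝ))).mul (hcst c)
  have hTev : ∀ᶠ t in 𝓝[>] (0:ℝ), 0 < t ∧ t < T := Ioo_mem_nhdsGT hT
  set f : Fin N → (Fin N → ℝ) → ℝ := fun i z => P i z - D i z with hf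
  have hfs : ∀ i z, f i z = ∑ j, (p i j z - d i j z) := fun i z => by
    simp [hf, hP, hD]
  have hfC : ∀ i, ContDiff ℝ 2 (f i) := fun i => by
    have : f i = fun z => ∑ j, (p i j z - d i j z) := funext (hfs i)
    rw [this]
    exact ContDiff.sum fun j _ => (hpC2 i j).sub (hdC2 i j)
  set F : Fin N → ℝ := fun i => f i yn with hF
  -- vector versions
  have hvec : ∀ (Z : ℝ → Fin N → ℝ) (v : Fin N → ℝ),
      (∀ i, (fun t => Z t i - yn i - t * v i) =O[𝓝[>] (0:ℝ)] fun t => t ^ 2) →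
      (fun t => Z t - yn - t • v) =O[𝓝[>] (0:ℝ)] fun t => t ^ 2 := fun Z v h => isBigO_pi.2 h
  have hlip : ∀ (h : (Fin N → ℝ) → ℝ), ContDiff ℝ 2 h → ∀ Z : ℝ → Fin N → ℝ,
      (∀ i, (fun t => Z t i - yn i) =O[𝓝[>] (0:ℝ)] fun t => t ^ 1) →
      (fun t => h (Z t) - h yn) =O[𝓝[>] (0:ℝ)] fun t => t ^ 1 := by
    intro h hh Z hZ
    have hZv : (fun t => Z t - yn) =O[𝓝[>] (0:ℝ)] fun t => t ^ 1 := isBigO_pi.2 hZ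
    have hZt : Tendsto Z (𝓝[>] (0:ℝ)) (𝓝 yn) := by
      have := hZv.trans_tendsto (by simpa using ht0)
      simpa using this.add_const yn
    have hd : DifferentiableAt ℝ h yn := (hh.differentiable (by norm_num)) yn
    exact (hd.isBigO_sub.comp_tendsto hZt).trans hZv
  -- exact solution
  have hyd : ∀ i, ∀ t ∈ Set.Icc 0 T,
      HasDerivWithinAt (fun s => y (tn + s) i) (f i (y (tn + t))) (Set.Icc 0 T) t := by
    intro i t ht
    have h1 := hy i (tn + t) ⟨by linarith [ht.1], by linarith [ht.2]⟩
    have h2 : HasDerivWithinAt (fun s => tn + s) 1 (Set.Icc 0 T) t :=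
      ((hasDerivAt_id t).const_add tn).hasDerivWithinAt
    have h3 := h1.comp t h2 (fun s hs => ⟨by linarith [hs.1], by linarith [hs.2]⟩)
    simpa [Function.comp_def] using h3
  have hsubT : 𝓝[>] (0:ℝ) ≤ 𝓝[Set.Icc 0 T] 0 := by
    rw [← nhdsWithin_Ioo_eq_nhdsGT hT]
    exact nhdsWithin_mono _ Set.Ioo_subset_Icc_self
  have hy1 : ∀ i, (fun t => y (tn + t) i - yn i) =O[𝓝[>] (0:ℝ)] fun t => t ^ 1 := by
    intro i
    have := ((hyd i 0 ⟨le_rfl, hT.le⟩).differentiableWithinAt.isBigO_sub).mono hsubT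
    simpa [hyn] using this
  have hy2 : ∀ i, (fun t => y (tn + t) i - yn i - t * F i) =O[𝓝[>] (0:ℝ)] fun t => t ^ 2 := by
    intro i
    apply mvt_O _ (fun t => f i (y (tn + t)) - F i) T hT 1
    · intro t ht
      have h1 : HasDerivWithinAt (fun s : ℝ => s * F i) (F i) (Set.Icc 0 T) t := by
        simpa using ((hasDerivAt_id t).mul_const (F i)).hasDerivWithinAt
      exact ((hyd i t ht).sub_const (yn i)).sub h1
    · simp [hyn]
    · simp [hyn, hF]
    · exact hlip (f i) (hfC i) (fun t => y (tn + t)) hy1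
  have hy3 : ∀ i, (fun t => y (tn + t) i - yn i - t * F i - t ^ 2 / 2 * fderiv ℝ (f i) yn F)
      =O[𝓝[>] (0:ℝ)] fun t => t ^ 3 := by
    intro i
    apply mvt_O _ (fun t => f i (y (tn + t)) - F i - t * fderiv ℝ (f i) yn F) T hT 2
    · intro t ht
      have h1 : HasDerivWithinAt (fun s : ℝ => s * F i) (F i) (Set.Icc 0 T) t := by
        simpa using ((hasDerivAt_id t).mul_const (F i)).hasDerivWithinAt
      have h2 : HasDerivWithinAt (fun s : ℝ => s ^ 2 / 2 * fderiv ℝ (f i) yn F)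
          (t * fderiv ℝ (f i) yn F) (Set.Icc 0 T) t := by
        have := (((hasDerivAt_pow 2 t).div_const 2).mul_const
          (fderiv ℝ (f i) yn F)).hasDerivWithinAt (s := Set.Icc 0 T)
        refine this.congr_deriv ?_
        norm_num
      exact (((hyd i t ht).sub_const (yn i)).sub h1).sub h2
    · simp [hyn]
    · simp [hyn, hF]
    · exact taylor_curve (f i) yn F (hfC i).contDiffAt (fun t => y (tn + t)) (hvec _ _ hy2)
  -- first stage
  have hY2a : ∀ i, (fun t => Y2 t i - yn i) =O[𝓝[>] (0:ℝ)] fun t => t ^ 1 := by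
    apply lin_bdd yn Y2 (fun i j _ => α * p i j yn / yn j) (fun i j _ => α * d i j yn / yn i)
      (fun i j => hcst _) (fun i j => hcst _)
    filter_upwards [hTev] with t ht i
    refine (hY2 t ht.1 ht.2 i).trans ?_
    rw [mul_comm α t, mul_assoc, Finset.mul_sum]
    congr 2
    exact Finset.sum_congr rfl fun j _ => by ring
  have hY2b : ∀ i, (fun t => Y2 t i - yn i - t * (α * F i)) =O[𝓝[>] (0:ℝ)] fun t => t ^ 2 := by
    intro i
    have := step_O yn Y2 (fun t i => Y2 t i / yn i) (fun i j _ => α * p i j yn)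
      (fun i j _ => α * d i j yn) 1 (fun i j => hcst _) (fun i j => hcst _) (by
        intro i
        have h := (hY2a i).mul (hcst (yn i)⁻¹)
        simp only [mul_one] at h
        refine h.congr_left fun t => ?_
        have := (hynpos i).ne'
        field_simp) (by
        filter_upwards [hTev] with t ht i
        refine (hY2 t ht.1 ht.2 i).trans ?_
        rw [mul_comm α t, mul_assoc, Finset.mul_sum]
        congr 2
        exact Finset.sum_congr rfl fun j _ => by ring) i
    refine this.congr_left fun t => ?_
    rw [show F i = ∑ j, (p i j yn - d i j yn) from hfs i yn, Finset.mul_sum _ _ α]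
    congr 2
    exact Finset.sum_congr rfl fun j _ => by ring
  -- weights
  have hσ2 : ∀ i, (fun t => σ t i - yn i - t * F i) =O[𝓝[>] (0:ℝ)] fun t => t ^ 2 := by
    intro i
    have hne := (hynpos i).ne'
    have hD1 : HasDerivAt (fun x : ℝ => x ^ (1 / α)) (1 / α) 1 := by
      simpa using Real.hasDerivAt_rpow_const (x := 1) (p := 1 / α) (Or.inl one_ne_zero)
    have h1 := taylor_curve (fun x : ℝ => x ^ (1 / α)) 1 (α * F i / yn i)
      (Real.contDiffAt_rpow_const_of_ne one_ne_zero) (fun t => Y2 t i / yn i) (by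
        have h := (hY2b i).mul (hcst (yn i)⁻¹)
        simp only [mul_one] at h
        refine h.congr_left fun t => ?_
        simp only [smul_eq_mul]
        field_simp)
    have h2 := (hcst (yn i)).mul h1
    simp only [one_mul] at h2
    refine h2.congr' ?_ EventuallyEq.rfl
    filter_upwards [hTev] with t ht
    rw [hσ t ht.1 ht.2 i, hD1.hasFDerivAt.fderiv]
    simp
    field_simp
  have hσ1 : ∀ i, (fun t => σ t i - yn i) =O[𝓝[>] (0:ℝ)] fun t => t ^ 1 := by
    intro i
    exact (((hσ2 i).trans ht21).add (htc (F i))).congr_left fun t => by ring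
  have hσt : ∀ i, Tendsto (fun t => σ t i) (𝓝[>] (0:ℝ)) (𝓝 (yn i)) := by
    intro i
    have := (hσ1 i).trans_tendsto (by simpa using ht0)
    simpa using this.add_const (yn i)
  have hσinv : ∀ i, (fun t => (σ t i)⁻¹) =O[𝓝[>] (0:ℝ)] fun _ => (1:ℝ) := fun i =>
    ((hσt i).inv₀ (hynpos i).ne').isBigO_one ℝ
  have hσne : ∀ i, ∀ᶠ t in 𝓝[>] (0:ℝ), σ t i ≠ 0 := fun i => (hσt i).eventually_ne (hynpos i).ne'
  have hb : b1 + b2 = 1 := by rw [hb1, hb2]; ring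
  have hbα : b2 * α = 1 / 2 := by rw [hb2]; field_simp
  -- coefficients
  have hqd : ∀ h : (Fin N → ℝ) → ℝ, ContDiff ℝ 2 h →
      (fun t => b1 * h yn + b2 * h (Y2 t) - h yn) =O[𝓝[>] (0:ℝ)] fun t => t ^ 1 := by
    intro h hh
    have := (hcst b2).mul (hlip h hh Y2 hY2a)
    simp only [one_mul] at this
    refine this.congr_left fun t => ?_
    rw [show b1 = 1 - b2 by linarith]; ring
  have hqb : ∀ h : (Fin N → ℝ) → ℝ, ContDiff ℝ 2 h →
      (fun t => b1 * h yn + b2 * h (Y2 t)) =O[𝓝[>] (0:ℝ)] fun _ => (1:ℝ) := by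
    intro h hh
    exact (((hqd h hh).trans ht1).add (hcst (h yn))).congr_left fun t => by ring
  have hYa : ∀ i, (fun t => Y t i - yn i) =O[𝓝[>] (0:ℝ)] fun t => t ^ 1 := by
    apply lin_bdd yn Y (fun i j t => (b1 * p i j yn + b2 * p i j (Y2 t)) * (σ t j)⁻¹)
      (fun i j t => (b1 * d i j yn + b2 * d i j (Y2 t)) * (σ t i)⁻¹)
    · intro i j
      simpa using (hqb _ (hpC2 i j)).mul (hσinv j)
    · intro i j
      simpa using (hqb _ (hdC2 i j)).mul (hσinv i)
    · filter_upwards [hTev] with t ht i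
      refine (hY t ht.1 ht.2 i).trans ?_
      congr 2
      exact Finset.sum_congr rfl fun j _ => by ring
  have hw : ∀ k, (∀ i, (fun t => Y t i - σ t i) =O[𝓝[>] (0:ℝ)] fun t => t ^ k) →
      ∀ i, (fun t => Y t i / σ t i - 1) =O[𝓝[>] (0:ℝ)] fun t => t ^ k := by
    intro k hk i
    have h := (hk i).mul (hσinv i)
    simp only [mul_one] at h
    refine h.congr' ?_ EventuallyEq.rfl
    filter_upwards [hσne i] with t ht
    field_simp
  have hstep : ∀ k, (∀ i, (fun t => Y t i - σ t i) =O[𝓝[>] (0:ℝ)] fun t => t ^ k) →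
      ∀ i, (fun t => Y t i - yn i - t * (b1 * f i yn + b2 * f i (Y2 t)))
        =O[𝓝[>] (0:ℝ)] fun t => t ^ (k + 1) := by
    intro k hk i
    have := step_O yn Y (fun t i => Y t i / σ t i)
      (fun i j t => b1 * p i j yn + b2 * p i j (Y2 t))
      (fun i j t => b1 * d i j yn + b2 * d i j (Y2 t)) k
      (fun i j => hqb _ (hpC2 i j)) (fun i j => hqb _ (hdC2 i j)) (hw k hk) (by
        filter_upwards [hTev] with t ht i
        refine (hY t ht.1 ht.2 i).trans ?_
        congr 2
        exact Finset.sum_congr rfl fun j _ => by ring) i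
    refine this.congr_left fun t => ?_
    rw [hfs i yn, hfs i (Y2 t), Finset.mul_sum _ _ b1, Finset.mul_sum (a := b2), ← Finset.sum_add_distrib]
    congr 2
    exact Finset.sum_congr rfl fun j _ => by ring
  have hYb : ∀ i, (fun t => Y t i - yn i - t * F i) =O[𝓝[>] (0:ℝ)] fun t => t ^ 2 := by
    intro i
    have h1 := hstep 1 (fun i => ((hYa i).sub (hσ1 i)).congr_left fun t => by ring) i
    have h2 := (isBigO_refl (fun t : ℝ => t) (𝓝[>] (0:ℝ))).mul (hqd (f i) (hfC i))
    have h3 : (fun t : ℝ => t * t ^ 1) = fun t => t ^ 2 := by funext t; ring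
    rw [h3] at h2
    exact (h1.add h2).congr_left fun t => by simp only [hF]; ring
  have hYc := hstep 2 (fun i => ((hYb i).sub (hσ2 i)).congr_left fun t => by ring)
  intro i
  have hfY2 := taylor_curve (f i) yn (α • F) (hfC i).contDiffAt Y2 (hvec _ _ hY2b)
  have h2 := (isBigO_refl (fun t : ℝ => t) (𝓝[>] (0:ℝ))).mul ((hcst b2).mul hfY2)
  have h3 : (fun t : ℝ => t * (1 * t ^ 2)) = fun t => t ^ 3 := by funext t; ring
  rw [h3] at h2
  have hfin : (fun t => Y t i - y (tn + t) i) =O[𝓝[>] (0:ℝ)] fun t => t ^ 3 := by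
    refine (((hYc i).add h2).sub (hy3 i)).congr_left fun t => ?_
    simp only [hF, map_smul, smul_eq_mul]
    linear_combination (t ^ 2 * fderiv ℝ (f i) yn (fun i => f i yn)) * (-hbα) - t * f i yn * hb
  obtain ⟨C, hCp, hC⟩ := hfin.exists_pos
  obtain ⟨δ, hδ, hbd⟩ := mem_nhdsGT_iff_exists_Ioo_subset.1 hC.bound
  refine ⟨C, hCp, δ, hδ, fun t h0 h1 => ?_⟩
  have hh : ‖Y t i - y (tn + t) i‖ ≤ C * ‖t ^ 3‖ := hbd ⟨h0, h1⟩
  rw [Real.norm_of_nonneg (r := t ^ 3) (by positivity)] at hh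
  exact hh
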